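/- arXiv:0808.2080 — 3 statements merged into one kernel-verified Lean document; each statement's English description precedes it below -/
import Mathlib

section
/- Let M be a metric space and let L : [0,1] → Set M be a set-valued map such that for every t ∈ [0,1] and every ε > 0 there exists δ > 0 with: for all s ∈ [0,1], |s − t| < δ implies L(t) ⊆ N(L(s), ε). Then for every ε > 0 and every finite set F ⊆ [0,1] there exist points 0 = t_1 < t_2 < ⋯ < t_n = 1 with F ⊆ {t_1, …, t_n} and sets I(1), …, I(n), each open in [0,1] and connected, whose union is [0,1], such that t_i ∈ I(j) if and only if i = j, and for every i and every t ∈ I(i) one has L(t_i) ⊆ N(L(t), ε). (This is the metric-space form of the paper's discrete approximation lemma, Lemma 4.1, stated with exactly the continuity property of the set-valued map that the paper's proof uses.) -/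
/-- The closed `ε`-neighborhood of a set `A` in a metric space. -/
def clNbhd {M : Type*} [MetricSpace M] (A : Set M) (ε : ℝ) : Set M :=
  {x | ∃ a ∈ A, dist x a ≤ ε}

open Topology in
theorem link_right {G : unitInterval → unitInterval → Prop}
    (hG : ∀ p, ∀ᶠ s in 𝓝 p, G p s) {p q : unitInterval} (hpq : p < q)
    (h : ∀ s, p ≤ s → s < q → G p s) :
    ∃ l r, p ≤ l ∧ l < r ∧ r ≤ q ∧ (∀ s, p ≤ s → s < r → G p s) ∧
      (∀ s, l < s → s ≤ q → G q s) := by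
  obtain ⟨l, hl, hls⟩ := exists_Ioc_subset_of_mem_nhds (hG q) ⟨p, hpq⟩
  exact ⟨max l p, q, le_max_right _ _, max_lt hl hpq, le_rfl, h,
    fun s h1 h2 => hls ⟨lt_of_le_of_lt (le_max_left _ _) h1, h2⟩⟩

open Topology in
theorem link_left {G : unitInterval → unitInterval → Prop}
    (hG : ∀ p, ∀ᶠ s in 𝓝 p, G p s) {p q : unitInterval} (hpq : p < q)
    (h : ∀ s, p < s → s ≤ q → G q s) :
    ∃ l r, p ≤ l ∧ l < r ∧ r ≤ q ∧ (∀ s, p ≤ s → s < r → G p s) ∧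
      (∀ s, l < s → s ≤ q → G q s) := by
  obtain ⟨r, hr, hrs⟩ := exists_Ico_subset_of_mem_nhds (hG p) ⟨q, hpq⟩
  exact ⟨p, min r q, le_rfl, lt_min hr hpq, min_le_right _ _,
    fun s h1 h2 => hrs ⟨h1, lt_of_lt_of_le h2 (min_le_left _ _)⟩, h⟩

open Topology in
theorem chain_exists {G : unitInterval → unitInterval → Prop}
    (hG : ∀ p, ∀ᶠ s in 𝓝 p, G p s) :
    ∃ (n : ℕ) (t : ℕ → unitInterval), t 0 = 0 ∧ t n = 1 ∧ ∀ i < n,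
      ∃ l r, t i ≤ l ∧ l < r ∧ r ≤ t (i+1) ∧ (∀ s, t i ≤ s → s < r → G (t i) s) ∧
      (∀ s, l < s → s ≤ t (i+1) → G (t (i+1)) s) := by
  set Lk : unitInterval → unitInterval → Prop := fun p q =>
    ∃ l r, p ≤ l ∧ l < r ∧ r ≤ q ∧ (∀ s, p ≤ s → s < r → G p s) ∧
      (∀ s, l < s → s ≤ q → G q s) with hLk
  let S : Set unitInterval := {y | ∃ (n : ℕ) (t : ℕ → unitInterval), t 0 = 0 ∧ t n = y ∧
    ∀ i < n, Lk (t i) (t (i+1))}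
  have step : ∀ x y, x ∈ S → Lk x y → y ∈ S := by
    rintro x y ⟨n, t, h0, hn, h⟩ hxy
    refine ⟨n+1, fun i => if i ≤ n then t i else y, by simp [h0], by simp, ?_⟩
    intro i hi
    rcases Nat.lt_succ_iff_lt_or_eq.mp hi with h' | rfl
    · have h1 : i + 1 ≤ n := h'
      have h2 : i ≤ n := h'.le
      simpa only [h1, h2, if_true] using h i h'
    · have h1 : ¬ (i + 1 ≤ i) := by omega
      simpa only [h1, le_refl, if_true, if_false, hn] using hxy
  have h0S : (0 : unitInterval) ∈ S := ⟨0, fun _ => 0, rfl, rfl, by simp⟩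
  obtain ⟨x, hx⟩ : ∃ x, IsLUB S x := ⟨sSup S, isLUB_sSup S⟩
  have hxS : x ∈ S := by
    by_cases hx0 : x = 0
    · rwa [hx0]
    have hx0 : 0 < x := unitInterval.pos_iff_ne_zero.mpr hx0
    obtain ⟨l, hl, hls⟩ := exists_Ioc_subset_of_mem_nhds (hG x) ⟨0, hx0⟩
    obtain ⟨y, hy, hly, hyx⟩ := hx.exists_between hl
    rcases hyx.eq_or_lt with rfl | hyx
    · exact hy
    · exact step y x hy (link_left hG hyx fun s h1 h2 => hls ⟨hly.trans h1, h2⟩)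
  have hx1 : x = 1 := by
    by_contra hne
    have hx1 : x < 1 := unitInterval.lt_one_iff_ne_one.mpr hne
    obtain ⟨r, hr, hrs⟩ := exists_Ico_subset_of_mem_nhds (hG x) ⟨1, hx1⟩
    have := step x r hxS (link_right hG hr fun s h1 h2 => hrs ⟨h1, h2⟩)
    exact absurd (hx.1 this) (not_le.mpr hr)
  rw [hx1] at hxS
  exact hxS

/-- Metric-space form of the discrete approximation lemma (Lemma 4.1). -/
theorem discrete_approximation {M : Type*} [MetricSpace M]
    (L : unitInterval → Set M)
    (hL : ∀ t : unitInterval, ∀ ε : ℝ, 0 < ε → ∃ δ : ℝ, 0 < δ ∧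
      ∀ s : unitInterval, dist s t < δ → L t ⊆ clNbhd (L s) ε)
    (ε : ℝ) (hε : 0 < ε) (F : Set unitInterval) (hF : F.Finite) :
    ∃ (n : ℕ) (hn : 2 ≤ n) (t : Fin n → unitInterval) (I : Fin n → Set unitInterval),
      StrictMono t ∧
      t ⟨0, by omega⟩ = 0 ∧
      t ⟨n - 1, by omega⟩ = 1 ∧
      F ⊆ Set.range t ∧
      (∀ j, IsOpen (I j)) ∧
      (∀ j, IsPreconnected (I j)) ∧
      (⋃ j, I j) = Set.univ ∧
      (∀ i j, t i ∈ I j ↔ i = j) ∧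
      (∀ i, ∀ s ∈ I i, L (t i) ⊆ clNbhd (L s) ε) := by
  have hG : ∀ p, ∀ᶠ s in nhds p, (L p ⊆ clNbhd (L s) ε ∧ (s ∈ F → s = p)) := by
    intro p
    apply Filter.Eventually.and
    · obtain ⟨δ, h1, h2⟩ := hL p ε hε
      exact Metric.eventually_nhds_iff.mpr ⟨δ, h1, fun {s} hs => h2 s hs⟩
    · have h : (F \ {p})ᶜ ∈ nhds p :=
        (hF.subset Set.sdiff_subset).isClosed.isOpen_compl.mem_nhds (by simp)
      filter_upwards [h] with s hs hsF
      by_contra hne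
      exact hs ⟨hsF, hne⟩
  obtain ⟨n, t, h0, h1, hlk⟩ := chain_exists hG
  choose! l r hl hlr hr hGl hGr using hlk
  have hn : 1 ≤ n := by
    rcases Nat.eq_zero_or_pos n with rfl | h
    · rw [h0] at h1; exact absurd h1 zero_ne_one
    · exact h
  have hstep : ∀ i < n, t i < t (i+1) := fun i hi =>
    lt_of_le_of_lt (hl i hi) ((hlr i hi).trans_le (hr i hi))
  have hmono : ∀ i j, i < j → j ≤ n → t i < t j := by
    intro i j hij
    induction j, hij using Nat.le_induction with
    | base => intro h; exact hstep i h
    | succ j hj ih => intro h; exact (ih (by omega)).trans (hstep j h)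
  have hmono' : ∀ i j, i ≤ j → j ≤ n → t i ≤ t j := by
    intro i j hij hj
    rcases hij.eq_or_lt with rfl | h
    · exact le_rfl
    · exact (hmono i j h hj).le
  have hlt : ∀ i < n, l i < t (i+1) := fun i hi => (hlr i hi).trans_le (hr i hi)
  have htr : ∀ i < n, t i < r i := fun i hi => (hl i hi).trans_lt (hlr i hi)
  let J : ℕ → Set unitInterval := fun i => {s | (i ≠ 0 → l (i-1) < s) ∧ (i ≠ n → s < r i)}
  have hJG : ∀ i ≤ n, ∀ s ∈ J i, (L (t i) ⊆ clNbhd (L s) ε ∧ (s ∈ F → s = t i)) := by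
    intro i hi s hs
    rcases le_or_gt (t i) s with h | h
    · by_cases hin : i = n
      · have : s = t i := le_antisymm (by rw [hin, h1]; exact unitInterval.le_one') h
        rw [this]; exact (hG (t i)).self_of_nhds
      · exact hGl i (by omega) s h (hs.2 hin)
    · have hi0 : i ≠ 0 := by
        rintro rfl
        rw [h0] at h
        exact absurd h (not_lt.mpr unitInterval.nonneg')
      obtain ⟨k, rfl⟩ := Nat.exists_eq_succ_of_ne_zero hi0
      exact hGr k (by omega) s (by simpa using hs.1 hi0) h.le
  have hcov : ∀ s, ∃ i ≤ n, s ∈ J i := by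
    intro s
    have hP0 : t 0 ≤ s := by rw [h0]; exact unitInterval.nonneg'
    obtain ⟨i, hi, his, hmax⟩ : ∃ i ≤ n, t i ≤ s ∧ (i < n → s < t (i+1)) := by
      classical
      refine ⟨Nat.findGreatest (fun i => t i ≤ s) n, Nat.findGreatest_le _,
        Nat.findGreatest_spec (P := fun i => t i ≤ s) (Nat.zero_le n) hP0, fun h => ?_⟩
      exact not_le.mp (Nat.findGreatest_is_greatest (P := fun i => t i ≤ s)
        (Nat.lt_succ_self _) h)
    have hleft : i ≠ 0 → l (i-1) < s := by
      intro h
      have := hlt (i-1) (by omega)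
      rw [Nat.sub_add_cancel (by omega)] at this
      exact this.trans_le his
    by_cases hin : i = n
    · exact ⟨i, hi, hleft, fun h => absurd hin h⟩
    have hin' : i < n := by omega
    rcases lt_or_ge s (r i) with h | h
    · exact ⟨i, hi, hleft, fun _ => h⟩
    · refine ⟨i+1, hin', fun _ => by simpa using (hlr i hin').trans_le h, fun h' => ?_⟩
      exact (hmax hin').trans (htr _ (by omega))
  have hJt : ∀ i ≤ n, ∀ j ≤ n, (t i ∈ J j ↔ i = j) := by
    intro i hi j hj
    constructor
    · intro h
      by_contra hne
      rcases lt_or_gt_of_ne hne with hij | hij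
      · have h2 := h.1 (by omega)
        have h3 := hl (j-1) (by omega)
        have h4 := hmono' i (j-1) (by omega) (by omega)
        exact absurd h2 (not_lt.mpr (h4.trans h3))
      · have h2 := h.2 (by omega)
        have h3 := hr j (by omega)
        have h4 := hmono' (j+1) i (by omega) (by omega)
        exact absurd h2 (not_lt.mpr (h3.trans h4))
    · rintro rfl
      refine ⟨fun h => ?_, fun h => htr i (by omega)⟩
      have := hlt (i-1) (by omega)
      rwa [Nat.sub_add_cancel (by omega)] at this
  refine ⟨n+1, by omega, fun i => t i, fun i => J i, ?_, h0, by simpa using h1, ?_, ?_, ?_, ?_,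
    ?_, ?_⟩
  · intro i j hij
    exact hmono i j hij (by omega)
  · intro f hf
    obtain ⟨i, hi, hfi⟩ := hcov f
    exact ⟨⟨i, by omega⟩, ((hJG i hi f hfi).2 hf).symm⟩
  · intro j
    refine IsOpen.inter (s := {s | (j : ℕ) ≠ 0 → l (j-1) < s})
      (t := {s | (j : ℕ) ≠ n → s < r j}) ?_ ?_
    · by_cases h : (j : ℕ) = 0
      · simp [h]
      · simpa [h] using isOpen_lt continuous_const continuous_id
    · by_cases h : (j : ℕ) = n
      · simp [h]
      · simpa [h] using isOpen_lt continuous_id continuous_const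
  · intro j
    apply Set.OrdConnected.isPreconnected
    refine ⟨fun x hx y hy z hz => ⟨fun h => (hx.1 h).trans_le hz.1,
      fun h => hz.2.trans_lt (hy.2 h)⟩⟩
  · refine Set.eq_univ_of_forall fun s => ?_
    obtain ⟨i, hi, hs⟩ := hcov s
    exact Set.mem_iUnion.mpr ⟨⟨i, by omega⟩, hs⟩
  · intro i j
    rw [Fin.ext_iff]
    exact hJt i (by omega) j (by omega)
  · intro i s hs
    exact (hJG i (by omega) s hs).1
end

section
/- Let M be a metric space, let (T_i, ℐ_i), i = 1, 2, …, be an infinite pointed open covering sequence of [0,1], let L_i : [0,1] → Set M be set-valued maps, and let ε_i > 0 satisfy ε_{i+1} < ε_i/2 for all i. Assume the sublimit condition holds: whenever I_i(j) ∩ I_{i+1}(k) ≠ ∅ and t ∈ I_{i+1}(k), then L_i(t^i_j) ⊆ N(L_{i+1}(t), ε_i). Then for all i, all indices j with 1 ≤ j ≤ n_i, all t ∈ I_i(j), and all n > i, one has L_i(t^i_j) ⊆ N(L_n(t), 2ε_i). (This is the Claim in the proof of Lemma 4.3 of the paper, stated for set-valued maps into a metric space, which is the only structure the paper's proof uses.)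 -/
/-- A pointed open covering of the unit interval `[0,1]`. -/
structure PointedOpenCover where
  /-- number of points -/
  n : ℕ
  hn : 2 ≤ n
  /-- the points `0 = t 0 < t 1 < ⋯ < t (n-1) = 1` -/
  t : Fin n → unitInterval
  t_mono : StrictMono t
  t_first : t ⟨0, by omega⟩ = 0
  t_last : t ⟨n - 1, by omega⟩ = 1
  /-- the open connected sets -/
  I : Fin n → Set unitInterval
  I_open : ∀ j, IsOpen (I j)
  I_conn : ∀ j, IsPreconnected (I j)
  I_cover : ∀ s : unitInterval, ∃ j, s ∈ I j
  t_mem : ∀ i, t i ∈ I i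
  I_overlap : ∀ j k, (I j ∩ I k).Nonempty → |((j : ℕ) : ℤ) - ((k : ℕ) : ℤ)| ≤ 1

/-- `c₂` refines `c₁`. -/
def PointedOpenCover.Refines (c₂ c₁ : PointedOpenCover) : Prop :=
  Set.range c₁.t ⊆ Set.range c₂.t ∧ ∀ j, ∃ k, c₂.I j ⊆ c₁.I k

/-- An infinite pointed open covering sequence. -/
def IsPointedOpenCoverSeq (c : ℕ → PointedOpenCover) : Prop :=
  ∀ i, (c (i + 1)).Refines (c i)

/-- The Claim in the proof of Lemma 4.3. -/
theorem sublimit_claim {M : Type*} [MetricSpace M]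
    (c : ℕ → PointedOpenCover) (hc : IsPointedOpenCoverSeq c)
    (L : ℕ → unitInterval → Set M) (ε : ℕ → ℝ)
    (hε : ∀ i, 0 < ε i) (hε2 : ∀ i, ε (i + 1) < ε i / 2)
    (hsub : ∀ i, ∀ j : Fin (c i).n, ∀ k : Fin (c (i + 1)).n,
      ((c i).I j ∩ (c (i + 1)).I k).Nonempty →
      ∀ t ∈ (c (i + 1)).I k, L i ((c i).t j) ⊆ clNbhd (L (i + 1) t) (ε i)) :
    ∀ i, ∀ j : Fin (c i).n, ∀ t ∈ (c i).I j, ∀ n, i < n →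
      L i ((c i).t j) ⊆ clNbhd (L n t) (2 * ε i) := by
  intro i j t ht n hn
  obtain ⟨d, rfl⟩ : ∃ d, n = i + 1 + d := ⟨n - (i + 1), by omega⟩
  clear hn
  induction d generalizing i with
  | zero =>
    obtain ⟨k, hk⟩ := (c (i + 1)).I_cover t
    intro x hx
    obtain ⟨a, ha, hd⟩ := hsub i j k ⟨t, ht, hk⟩ t hk hx
    exact ⟨a, ha, by linarith [hε i]⟩
  | succ d ih =>
    obtain ⟨k, hk⟩ := (c (i + 1)).I_cover t
    intro x hx
    obtain ⟨a, ha, hd⟩ := hsub i j k ⟨t, ht, hk⟩ _ ((c (i + 1)).t_mem k) hx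
    obtain ⟨b, hb, hd2⟩ := ih (i + 1) k hk ha
    have e : i + 1 + (d + 1) = i + 1 + 1 + d := by omega
    rw [e]
    exact ⟨b, hb, by linarith [hε2 i, dist_triangle x a b]⟩
end

section
/- Let X be a Hausdorff topological space, let g : [0,1] → X be continuous, and let p, q be two distinct points of the image g([0,1]). Then there exists a continuous injective map h : [0,1] → X with h(0) = p, h(1) = q, and h([0,1]) ⊆ g([0,1]); that is, any two points of the continuous Hausdorff image of [0,1] are joined by an embedded path inside that image. (Lemma 7.3 ('wilder') of the paper.) -/
open Set Filter Topology

def GoodSet {X : Type*} (g : unitInterval → X) (K : Set unitInterval) : Prop :=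
  IsClosed K ∧ 0 ∈ K ∧ 1 ∈ K ∧
    ∀ a ∈ K, ∀ b ∈ K, a < b → (∀ c ∈ K, a < c → c < b → False) → g a = g b

lemma exists_left {K : Set unitInterval} (hK : IsClosed K) (h0 : 0 ∈ K) (t : unitInterval) :
    ∃ r ∈ K, r ≤ t ∧ ∀ c ∈ K, c ≤ t → c ≤ r := by
  obtain ⟨r, hr, hr2⟩ := (hK.inter (isClosed_Iic (a := t))).isCompact.exists_isGreatest
    ⟨0, h0, unitInterval.nonneg'⟩
  exact ⟨r, hr.1, hr.2, fun c hc hct => hr2 ⟨hc, hct⟩⟩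

lemma exists_right {K : Set unitInterval} (hK : IsClosed K) (h1 : 1 ∈ K) (t : unitInterval) :
    ∃ r ∈ K, t ≤ r ∧ ∀ c ∈ K, t ≤ c → r ≤ c := by
  obtain ⟨r, hr, hr2⟩ := (hK.inter (isClosed_Ici (a := t))).isCompact.exists_isLeast
    ⟨1, h1, unitInterval.le_one'⟩
  exact ⟨r, hr.1, hr.2, fun c hc hct => hr2 ⟨hc, hct⟩⟩

lemma goodSet_sInter {X : Type*} [TopologicalSpace X] [T2Space X]
    {g : unitInterval → X} (hg : Continuous g) (S : Set (Set unitInterval))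
    (hS : ∀ K ∈ S, GoodSet g K) (hc : IsChain (· ⊆ ·) S) (hne : S.Nonempty) :
    GoodSet g (⋂₀ S) := by
  refine ⟨isClosed_sInter fun K hK => (hS K hK).1, fun K hK => (hS K hK).2.1,
    fun K hK => (hS K hK).2.2.1, ?_⟩
  intro a ha b hb hab hgap
  by_contra hne'
  obtain ⟨U, V, hU, hV, haU, hbV, hUV⟩ := t2_separation hne'
  obtain ⟨m, ham, hmb⟩ := exists_between hab
  obtain ⟨a', ha', haU'⟩ := (mem_nhdsGE_iff_exists_Ico_subset' hab).1
    (mem_nhdsWithin_of_mem_nhds ((hU.preimage hg).mem_nhds haU))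
  obtain ⟨b', hb', hbV'⟩ := (mem_nhdsLE_iff_exists_Ioc_subset' hab).1
    (mem_nhdsWithin_of_mem_nhds ((hV.preimage hg).mem_nhds hbV))
  simp only [mem_Ioi, mem_Iio] at ha' hb'
  have key : ∃ K ∈ S, K ∩ Icc (min a' m) (max b' m) = ∅ := by
    by_contra! hcon
    haveI : Nonempty S := hne.to_subtype
    have := IsCompact.nonempty_iInter_of_directed_nonempty_isCompact_isClosed
      (fun K : S => (K : Set unitInterval) ∩ Icc (min a' m) (max b' m)) (by
        rintro ⟨K, hK⟩ ⟨L, hL⟩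
        rcases hc.total hK hL with h | h
        · exact ⟨⟨K, hK⟩, Subset.rfl, inter_subset_inter_left _ h⟩
        · exact ⟨⟨L, hL⟩, inter_subset_inter_left _ h, Subset.rfl⟩)
      (fun K => hcon K K.2)
      (fun K => ((hS K K.2).1.inter isClosed_Icc).isCompact)
      (fun K => ((hS K K.2).1.inter isClosed_Icc))
    obtain ⟨x, hx⟩ := this
    rw [mem_iInter] at hx
    have hx2 := (hx this.some).2
    refine hgap x (fun K hK => (hx ⟨K, hK⟩).1) ?_ ?_
    · exact lt_of_lt_of_le (lt_min ha' ham) hx2.1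
    · exact lt_of_le_of_lt hx2.2 (max_lt hb' hmb)
  obtain ⟨K, hK, hKe⟩ := key
  have hG := hS K hK
  obtain ⟨r, hrK, hrm, hr⟩ := exists_left hG.1 hG.2.1 m
  obtain ⟨s, hsK, hsm, hs⟩ := exists_right hG.1 hG.2.2.1 m
  have hnot : ∀ x ∈ K, min a' m ≤ x → x ≤ max b' m → False := fun x hx h1 h2 =>
    (eq_empty_iff_forall_notMem.1 hKe) x ⟨hx, h1, h2⟩
  have har := hr a (ha K hK) ham.le
  have hsb := hs b (hb K hK) hmb.le
  have h1 : r < min a' m := by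
    by_contra! h
    exact hnot r hrK h (hrm.trans (le_max_right _ _))
  have h2 : max b' m < s := by
    by_contra! h
    exact hnot s hsK ((min_le_right _ _).trans hsm) h
  have h3 : g r ∈ U := haU' ⟨har, h1.trans_le (min_le_left _ _)⟩
  have h4 : g s ∈ V := hbV' ⟨(le_max_left _ _).trans_lt h2, hsb⟩
  have h5 : r < s := (h1.trans_le (min_le_right _ _)).trans_le hsm
  have h6 : g r = g s := hG.2.2.2 r hrK s hsK h5 (fun c hc h7 h8 => by
    rcases le_total c m with h | h
    · exact absurd (hr c hc h) (not_le.2 h7)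
    · exact absurd (hs c hc h) (not_le.2 h8))
  exact disjoint_left.1 hUV h3 (h6 ▸ h4)

lemma exists_min_good {X : Type*} [TopologicalSpace X] [T2Space X]
    {g : unitInterval → X} (hg : Continuous g) :
    ∃ K, GoodSet g K ∧ ∀ s ∈ K, ∀ t ∈ K, s < t → g s = g t →
      ∀ c ∈ K, s < c → c < t → False := by
  obtain ⟨K, -, hK⟩ := zorn_superset_nonempty {K | GoodSet g K}
    (fun c hc hch hne => ⟨⋂₀ c, goodSet_sInter hg c (fun K hK => hc hK) hch hne,
      fun s hs => sInter_subset_of_mem hs⟩) univ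
    ⟨isClosed_univ, trivial, trivial, fun a _ b _ hab h => by
      obtain ⟨m, h1, h2⟩ := exists_between hab
      exact (h m trivial h1 h2).elim⟩
  have hG : GoodSet g K := hK.prop
  refine ⟨K, hG, ?_⟩
  intro s hs t ht hst hgst c hc hsc hct
  have hgood : GoodSet g (K \ Ioo s t) := by
    refine ⟨hG.1.sdiff isOpen_Ioo, ⟨hG.2.1, fun h => not_lt.2 unitInterval.nonneg' h.1⟩,
      ⟨hG.2.2.1, fun h => not_lt.2 unitInterval.le_one' h.2⟩, ?_⟩
    intro a ha b hb hab hgap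
    by_cases hd : ∃ x ∈ K, a < x ∧ x < b
    · obtain ⟨x, hx, hax, hxb⟩ := hd
      have hxst : x ∈ Ioo s t := by
        by_contra h
        exact hgap x ⟨hx, h⟩ hax hxb
      have h1 : ¬ (a < s ∧ s < b) := fun h => hgap s ⟨hs, fun h => lt_irrefl _ h.1⟩ h.1 h.2
      have h2 : ¬ (a < t ∧ t < b) := fun h => hgap t ⟨ht, fun h => lt_irrefl _ h.2⟩ h.1 h.2
      have h3 : ¬ (s < a ∧ a < t) := ha.2
      have h4 : ¬ (s < b ∧ b < t) := hb.2
      have h5 := hxst.1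
      have h6 := hxst.2
      have e1 : a = s := by grind
      have e2 : b = t := by grind
      rw [e1, e2, hgst]
    · exact hG.2.2.2 a ha.1 b hb.1 hab (fun x hx h1 h2 => hd ⟨x, hx, h1, h2⟩)
  exact (hK.le_of_le hgood sdiff_subset hc).2 ⟨hsc, hct⟩

lemma exists_monotone_path {X : Type*} [TopologicalSpace X] [T2Space X]
    {g : unitInterval → X} (hg : Continuous g) :
    ∃ f : unitInterval → X, Continuous f ∧ f 0 = g 0 ∧ f 1 = g 1 ∧ range f ⊆ range g ∧
      ∀ s t u, s ≤ u → u ≤ t → f s = f t → f u = f s := by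
  obtain ⟨K, hG, hmin⟩ := exists_min_good hg
  choose ρ hρK hρle hρ using exists_left hG.1 hG.2.1
  choose σ hσK hσle hσ using exists_right hG.1 hG.2.2.1
  have hmono : ∀ s t, s ≤ t → ρ s ≤ ρ t := fun s t h => hρ t _ (hρK s) ((hρle s).trans h)
  refine ⟨g ∘ ρ, ?_, ?_, ?_, range_comp_subset_range _ _, ?_⟩
  · rw [continuous_iff_ultrafilter]
    intro t F hF
    obtain ⟨r, -, hr⟩ := isCompact_univ.ultrafilter_le_nhds (F.map ρ) (by simp)
    obtain ⟨s, -, hs⟩ := isCompact_univ.ultrafilter_le_nhds (F.map σ) (by simp)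
    have hr' : Tendsto ρ F (𝓝 r) := hr
    have hs' : Tendsto σ F (𝓝 s) := hs
    have ht' : Tendsto id (F : Filter unitInterval) (𝓝 t) := hF
    have hrt : r ≤ t := le_of_tendsto_of_tendsto' hr' ht' hρle
    have hts : t ≤ s := le_of_tendsto_of_tendsto' ht' hs' hσle
    have hrK : r ∈ K := hG.1.mem_of_tendsto hr' (Eventually.of_forall hρK)
    have hsK : s ∈ K := hG.1.mem_of_tendsto hs' (Eventually.of_forall hσK)
    have hgap : ∀ c ∈ K, r < c → c < s → False := by
      intro c hc h1 h2
      obtain ⟨x, hx1, hx2⟩ := ((hr'.eventually (gt_mem_nhds h1)).and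
        (hs'.eventually (lt_mem_nhds h2))).exists
      rcases le_total c x with h | h
      · exact absurd (hρ x c hc h) (not_le.2 hx1)
      · exact absurd (hσ x c hc h) (not_le.2 hx2)
    have hval : g (ρ t) = g r := by
      have h1 : r ≤ ρ t := hρ t r hrK hrt
      have h2 := hρle t
      rcases h1.eq_or_lt with h | h
      · rw [← h]
      · have h3 : ρ t = s := by
          rcases (h2.trans hts).eq_or_lt with h4 | h4
          · exact h4
          · exact (hgap _ (hρK t) h h4).elim
        rw [h3]
        exact (hG.2.2.2 r hrK s hsK (h3 ▸ h) hgap).symm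
    show Tendsto (g ∘ ρ) F (𝓝 (g (ρ t)))
    rw [hval]
    exact (hg.tendsto r).comp hr'
  · show g (ρ 0) = g 0
    rw [le_antisymm (hρle 0) unitInterval.nonneg']
  · show g (ρ 1) = g 1
    rw [le_antisymm (hρle 1) (hρ 1 1 hG.2.2.1 le_rfl)]
  · intro s t u hsu hut h
    simp only [Function.comp] at h ⊢
    have h1 := hmono _ _ hsu
    have h2 := hmono _ _ hut
    rcases h1.eq_or_lt with e | h1
    · rw [← e]
    rcases h2.eq_or_lt with e | h2
    · rw [e, h]
    exact (hmin _ (hρK s) _ (hρK t) (h1.trans h2) h _ (hρK u) h1 h2).elim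

lemma exists_step {X : Type*} [TopologicalSpace X] [T2Space X]
    {f : unitInterval → X} (hf : Continuous f)
    (hmon : ∀ s t u, s ≤ u → u ≤ t → f s = f t → f u = f s)
    (r s : unitInterval) : ∃ φ : unitInterval → ℝ, Continuous φ ∧ Monotone φ ∧
      (∀ x, 0 ≤ φ x ∧ φ x ≤ 1) ∧ (∀ x y, f x = f y → φ x = φ y) ∧
      (r < s → f r ≠ f s → φ r < φ s) := by
  by_cases hrs : r < s ∧ f r ≠ f s
  swap
  · exact ⟨fun _ => 0, continuous_const, monotone_const, by simp, by simp,
      fun h1 h2 => (hrs ⟨h1, h2⟩).elim⟩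
  haveI : CompactSpace (range f) := isCompact_iff_compactSpace.1 (isCompact_range hf)
  obtain ⟨w, hw0, hw1, hw⟩ := exists_continuous_zero_one_of_isClosed
    (X := range f) (s := {⟨f r, mem_range_self r⟩}) (t := {⟨f s, mem_range_self s⟩})
    isClosed_singleton isClosed_singleton (by simpa using hrs.2)
  let v : unitInterval → ℝ := fun x => w ⟨f (max x r), mem_range_self _⟩
  have hv : Continuous v := by
    refine w.continuous.comp (Continuous.subtype_mk ?_ _)
    exact hf.comp (by fun_prop)
  have hv01 : ∀ x, 0 ≤ v x ∧ v x ≤ 1 := fun x => hw _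
  have hvr : ∀ x ≤ r, v x = 0 := by
    intro x hx
    have := hw0 (mem_singleton (⟨f r, mem_range_self r⟩ : range f))
    simp only [v, max_eq_right hx]
    simpa using this
  have hvs : v s = 1 := by
    have := hw1 (mem_singleton (⟨f s, mem_range_self s⟩ : range f))
    simp only [v, max_eq_left hrs.1.le]
    simpa using this
  have hvf : ∀ x y, f (max x r) = f (max y r) → v x = v y := by
    intro x y h
    simp only [v, h]
  let φ : unitInterval → ℝ := fun t => sSup ((fun x => v (min x t)) '' univ)
  have hbdd : ∀ t, BddAbove ((fun x => v (min x t)) '' univ) := by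
    intro t
    refine ⟨1, ?_⟩
    rintro _ ⟨x, -, rfl⟩
    exact (hv01 _).2
  have hle : ∀ x t, x ≤ t → v x ≤ φ t := by
    intro x t hx
    refine le_csSup (hbdd t) ⟨x, trivial, ?_⟩
    simp [min_eq_left hx]
  have hub : ∀ t c, (∀ x ≤ t, v x ≤ c) → φ t ≤ c := by
    intro t c h
    refine csSup_le ⟨_, ⟨0, trivial, rfl⟩⟩ ?_
    rintro _ ⟨x, -, rfl⟩
    exact h _ (min_le_right _ _)
  have hφm : Monotone φ := fun a b hab => hub a _ fun x hx => hle x b (hx.trans hab)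
  have hcon : ∀ x y, x ≤ y → f x = f y → φ y ≤ φ x := by
    intro x y hxy h
    refine hub _ _ fun z hz => ?_
    rcases le_total z x with hzx | hzx
    · exact hle z x hzx
    · have : v z = v x := by
        apply hvf
        rcases le_total z r with h1 | h1
        · rw [max_eq_right h1, max_eq_right (hzx.trans h1)]
        · rw [max_eq_left h1]
          rcases le_total x r with h2 | h2
          · rw [max_eq_right h2, hmon x y z hzx hz h, hmon x y r h2 (h1.trans hz) h]
          · rw [max_eq_left h2, hmon x y z hzx hz h]
      rw [this]
      exact hle x x le_rfl
  refine ⟨φ, ?_, hφm, ?_, ?_, ?_⟩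
  · refine isCompact_univ.continuous_sSup (f := fun t x => v (min x t)) ?_
    exact hv.comp (by fun_prop)
  · exact fun x => ⟨(hv01 x).1.trans (hle x x le_rfl), hub x 1 fun z _ => (hv01 z).2⟩
  · intro x y h
    rcases le_total x y with h1 | h1
    · exact le_antisymm (hφm h1) (hcon x y h1 h)
    · exact le_antisymm (hcon y x h1 h.symm) (hφm h1)
  · intro _ _
    calc φ r ≤ 0 := hub r 0 fun x hx => (hvr x hx).le
      _ < 1 := one_pos
      _ = v s := hvs.symm
      _ ≤ φ s := hle s s le_rfl

lemma exists_between_ne {X : Type*} [TopologicalSpace X] [T2Space X]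
    {f : unitInterval → X} (hf : Continuous f) (D : Set unitInterval) (hD : Dense D)
    (x y : unitInterval) (hxy : x < y) (h : f x ≠ f y) :
    ∃ r ∈ D, ∃ s ∈ D, x ≤ r ∧ r < s ∧ s ≤ y ∧ f r ≠ f s := by
  by_contra! hcon
  -- f is constant on D ∩ (x,y)
  have hcl : Icc x y ⊆ closure (Ioo x y ∩ D) := by
    rw [← closure_Ioo hxy.ne]
    exact closure_minimal (hD.open_subset_closure_inter isOpen_Ioo) isClosed_closure
  obtain ⟨d, hd, hdD⟩ := hD.inter_open_nonempty (Ioo x y) isOpen_Ioo (nonempty_Ioo.2 hxy)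
  have hconst : Ioo x y ∩ D ⊆ {z | f z = f d} := by
    rintro z ⟨hz, hzD⟩
    rcases lt_trichotomy z d with h1 | h1 | h1
    · exact hcon z hzD d hdD hz.1.le h1 hd.2.le
    · simp [h1]
    · exact (hcon d hdD z hzD hd.1.le h1 hz.2.le).symm
  have hall := hcl.trans (closure_minimal hconst (isClosed_eq hf continuous_const))
  exact h ((hall (left_mem_Icc.2 hxy.le)).trans (hall (right_mem_Icc.2 hxy.le)).symm)

lemma exists_param {X : Type*} [TopologicalSpace X] [T2Space X]
    {f : unitInterval → X} (hf : Continuous f)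
    (hmon : ∀ s t u, s ≤ u → u ≤ t → f s = f t → f u = f s) :
    ∃ φ : unitInterval → ℝ, Continuous φ ∧ Monotone φ ∧ ∀ x y, φ x = φ y ↔ f x = f y := by
  obtain ⟨D, hDc, hD⟩ := TopologicalSpace.exists_countable_dense unitInterval
  haveI : Countable D := hDc.to_subtype
  haveI : Encodable (D × D) := Encodable.ofCountable _
  choose φ hc hm h01 hconst hlt using exists_step hf hmon
  let c : D × D → ℝ := fun i => (1 / 2 : ℝ) ^ Encodable.encode i
  have hcs : Summable c := summable_geometric_two_encode
  have hcpos : ∀ i, 0 < c i := fun i => by positivity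
  have hb : ∀ (i : D × D) x, ‖c i * φ i.1 i.2 x‖ ≤ c i := by
    intro i x
    rw [Real.norm_of_nonneg (mul_nonneg (hcpos i).le (h01 _ _ x).1)]
    exact mul_le_of_le_one_right (hcpos i).le (h01 _ _ x).2
  have hsum : ∀ x, Summable fun i : D × D => c i * φ i.1 i.2 x :=
    fun x => Summable.of_norm_bounded hcs fun i => hb i x
  have hM : Monotone fun x => ∑' i : D × D, c i * φ i.1 i.2 x := fun x y hxy =>
    (hsum x).tsum_le_tsum (fun i => mul_le_mul_of_nonneg_left (hm _ _ hxy) (hcpos i).le) (hsum y)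
  have hL : ∀ x y, x < y → f x ≠ f y →
      ∑' i : D × D, c i * φ i.1 i.2 x < ∑' i : D × D, c i * φ i.1 i.2 y := by
    intro x y hxy h
    obtain ⟨r, hr, s, hs, h1, h2, h3, h4⟩ := exists_between_ne hf D hD x y hxy h
    refine Summable.tsum_lt_tsum (i := (⟨r, hr⟩, ⟨s, hs⟩))
      (fun i => mul_le_mul_of_nonneg_left (hm _ _ hxy.le) (hcpos i).le) ?_ (hsum x) (hsum y)
    refine mul_lt_mul_of_pos_left ?_ (hcpos _)
    exact (hm r s h1).trans_lt ((hlt r s h2 h4).trans_le (hm r s h3))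
  refine ⟨fun x => ∑' i : D × D, c i * φ i.1 i.2 x,
    continuous_tsum (fun i => continuous_const.mul (hc _ _)) hcs hb, hM, ?_⟩
  intro x y
  constructor
  · intro h
    by_contra hne
    rcases lt_trichotomy x y with h1 | h1 | h1
    · exact (hL x y h1 hne).ne h
    · exact hne (by rw [h1])
    · exact (hL y x h1 (Ne.symm hne)).ne h.symm
  · intro h
    simp only [hconst _ _ x y h]

/-- Lemma 7.3 ("wilder"): any two points of a continuous Hausdorff image of
`[0,1]` are joined by an embedded path inside that image. -/
theorem exists_embedded_path {X : Type*} [TopologicalSpace X] [T2Space X]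
    (g : unitInterval → X) (hg : Continuous g)
    (p q : X) (hp : p ∈ Set.range g) (hq : q ∈ Set.range g) (hpq : p ≠ q) :
    ∃ h : unitInterval → X, Continuous h ∧ Function.Injective h ∧
      h 0 = p ∧ h 1 = q ∧ Set.range h ⊆ Set.range g := by
  obtain ⟨a, rfl⟩ := hp
  obtain ⟨b, rfl⟩ := hq
  haveI : PathConnectedSpace unitInterval := isPathConnected_iff_pathConnectedSpace.1
    ((convex_Icc (0 : ℝ) 1).isPathConnected ⟨0, by simp⟩)
  let γ : Path a b := PathConnectedSpace.somePath a b
  obtain ⟨f, hf, hf0, hf1, hfr, hmon⟩ := exists_monotone_path (hg.comp γ.continuous)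
  simp only [Function.comp, Path.source, Path.target] at hf0 hf1
  obtain ⟨φ, hφ, hφm, hφf⟩ := exists_param hf hmon
  have h01 : φ 0 < φ 1 := lt_of_le_of_ne (hφm unitInterval.nonneg') fun h =>
    hpq (by rw [← hf0, ← hf1]; exact (hφf 0 1).1 h)
  have hd : 0 < φ 1 - φ 0 := sub_pos.2 h01
  let ψ : unitInterval → unitInterval := fun t => ⟨(φ t - φ 0) / (φ 1 - φ 0),
    div_nonneg (sub_nonneg.2 (hφm unitInterval.nonneg')) hd.le,
    (div_le_one hd).2 (sub_le_sub_right (hφm unitInterval.le_one') _)⟩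
  have hψ : Continuous ψ := by
    refine Continuous.subtype_mk ?_ _
    fun_prop
  have hψ0 : ψ 0 = 0 := by ext; simp [ψ]
  have hψ1 : ψ 1 = 1 := by ext; simp [ψ, hd.ne']
  have hψf : ∀ x y, ψ x = ψ y ↔ f x = f y := by
    intro x y
    rw [← hφf, Subtype.ext_iff]
    simp only [ψ]
    rw [div_left_inj' hd.ne', sub_left_inj]
  have hsurj : Function.Surjective ψ := by
    intro y
    have := intermediate_value_univ (0 : unitInterval) 1 hψ
    rw [hψ0, hψ1] at this
    exact this ⟨unitInterval.nonneg', unitInterval.le_one'⟩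
  have hquot : IsQuotientMap ψ := hψ.isClosedMap.isQuotientMap hψ hsurj
  choose τ hτ using hsurj
  have hfτ : ∀ x, f (τ (ψ x)) = f x := fun x => (hψf _ _).1 (hτ _)
  refine ⟨f ∘ τ, ?_, ?_, ?_, ?_, ?_⟩
  · rw [hquot.continuous_iff]
    have : (f ∘ τ) ∘ ψ = f := funext hfτ
    rw [this]; exact hf
  · intro x y h
    have := (hψf (τ x) (τ y)).2 h
    rwa [hτ, hτ] at this
  · rw [← hf0, ← hfτ 0, hψ0]; rfl
  · rw [← hf1, ← hfτ 1, hψ1]; rfl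
  · exact (range_comp_subset_range _ _).trans (hfr.trans (range_comp_subset_range _ _))
end
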